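/- Let A be an n×n real symmetric matrix, z ∈ ℂ \ ℝ, and G(z) = (zI − A)^{-1} (with A regarded as a complex matrix). Let F be a finite set of indices in {1,…,n} and (a_i)_{i∈F} positive real numbers. Then z − Σ_{i∈F} a_i G(z)_{ii} ≠ 0 and |z − Σ_{i∈F} a_i G(z)_{ii}| ≥ |Im(z)|. -/

import Mathlib

open Matrix in
/-- The imaginary part of a diagonal resolvent entry has sign opposite to `Im z`. -/
theorem resolvent_im_sign (n : ℕ) (A : Matrix (Fin n) (Fin n) ℝ) (hA : A.IsSymm) (z : ℂ)
    (i : Fin n) :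
    z.im * (((z • (1 : Matrix (Fin n) (Fin n) ℂ) - A.map Complex.ofReal)⁻¹) i i).im ≤ 0 := by
  set B : Matrix (Fin n) (Fin n) ℂ := A.map Complex.ofReal with hB
  have hBh : B.IsHermitian := by
    ext j k
    have := hA.apply j k
    simp [hB, this]
  by_cases hu : IsUnit (z • (1 : Matrix (Fin n) (Fin n) ℂ) - B).det
  · set G := (z • (1 : Matrix (Fin n) (Fin n) ℂ) - B)⁻¹ with hG
    have h1 : (z • (1 : Matrix (Fin n) (Fin n) ℂ) - B) * G = 1 := Matrix.mul_nonsing_inv _ hu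
    have h2 : Gᴴ = z • (Gᴴ * G) - Gᴴ * B * G := by
      calc Gᴴ = Gᴴ * ((z • (1 : Matrix (Fin n) (Fin n) ℂ) - B) * G) := by rw [h1, mul_one]
        _ = _ := by simp [sub_mul, mul_sub, mul_assoc]
    have h3 : ((Gᴴ * B * G) i i).im = 0 := by
      have := (isHermitian_conjTranspose_mul_mul G hBh).apply i i
      exact Complex.conj_eq_iff_im.mp this
    have h4 : ((Gᴴ * G) i i).im = 0 := by
      have := (isHermitian_conjTranspose_mul_self G).apply i i
      exact Complex.conj_eq_iff_im.mp this
    have h5 : 0 ≤ ((Gᴴ * G) i i).re := by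
      rw [Matrix.mul_apply, Complex.re_sum]
      refine Finset.sum_nonneg fun k _ => ?_
      simp [Matrix.conjTranspose_apply, Complex.mul_re]
      nlinarith [mul_self_nonneg (G k i).re, mul_self_nonneg (G k i).im]
    have h6 := congrArg Complex.im (congrFun (congrFun h2 i) i)
    simp only [Matrix.sub_apply, Matrix.smul_apply, smul_eq_mul, Complex.sub_im, Complex.mul_im,
      h3, h4, Matrix.conjTranspose_apply, Complex.star_def, Complex.conj_im] at h6
    have h7 : (G i i).im = -(z.im * ((Gᴴ * G) i i).re) := by linarith
    have h8 := mul_nonneg (mul_self_nonneg z.im) h5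
    rw [h7]
    linarith
  · rw [Matrix.nonsing_inv_apply_not_isUnit _ hu]
    simp

/-- For an `n × n` real symmetric matrix `A`, non-real `z`, resolvent `G(z) = (zI - A)⁻¹`,
a finite set `F` of indices and positive reals `(a i)_{i ∈ F}`:
`z - ∑_{i ∈ F} aᵢ G(z)ᵢᵢ ≠ 0` and `|z - ∑_{i ∈ F} aᵢ G(z)ᵢᵢ| ≥ |Im z|`. -/
theorem stmt_3 (n : ℕ) (A : Matrix (Fin n) (Fin n) ℝ) (hA : A.IsSymm)
    (z : ℂ) (hz : z.im ≠ 0) (F : Finset (Fin n)) (a : Fin n → ℝ)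
    (ha : ∀ i ∈ F, 0 < a i) :
    (z - ∑ i ∈ F, (a i : ℂ) *
        ((z • (1 : Matrix (Fin n) (Fin n) ℂ) - A.map Complex.ofReal)⁻¹) i i) ≠ 0 ∧
    |z.im| ≤ norm (z - ∑ i ∈ F, (a i : ℂ) *
        ((z • (1 : Matrix (Fin n) (Fin n) ℂ) - A.map Complex.ofReal)⁻¹) i i) := by
  have key : z.im * z.im ≤ z.im * (z - ∑ i ∈ F, (a i : ℂ) *
      ((z • (1 : Matrix (Fin n) (Fin n) ℂ) - A.map Complex.ofReal)⁻¹) i i).im := by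
    rw [Complex.sub_im, Complex.im_sum, mul_sub, Finset.mul_sum]
    have : ∑ i ∈ F, z.im * ((a i : ℂ) *
      ((z • (1 : Matrix (Fin n) (Fin n) ℂ) - A.map Complex.ofReal)⁻¹) i i).im ≤ 0 := by
      refine Finset.sum_nonpos fun i hi => ?_
      rw [Complex.im_ofReal_mul]
      nlinarith [resolvent_im_sign n A hA z i, ha i hi]
    linarith
  have h2 : |z.im| ≤ norm (z - ∑ i ∈ F, (a i : ℂ) *
      ((z • (1 : Matrix (Fin n) (Fin n) ℂ) - A.map Complex.ofReal)⁻¹) i i) := by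
    refine le_trans ?_ (Complex.abs_im_le_norm _)
    have hp : 0 < |z.im| := abs_pos.mpr hz
    refine le_of_mul_le_mul_left ?_ hp
    rw [abs_mul_abs_self, ← abs_mul]
    exact key.trans (le_abs_self _)
  refine ⟨fun h => ?_, h2⟩
  rw [h, norm_zero] at h2
  exact hz (abs_nonpos_iff.mp h2)
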